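/- The Grigorchuk group G is a periodic 2-group: for every g ∈ G there exists a natural number k such that g^(2^k) is the identity automorphism. -/

import Mathlib

namespace Grig

def aFun : List Bool → List Bool
  | [] => []
  | x :: v => (!x) :: v

mutual
  def bFun : List Bool → List Bool
    | [] => []
    | false :: v => false :: aFun v
    | true :: v => true :: cFun v
  def cFun : List Bool → List Bool
    | [] => []
    | false :: v => false :: aFun v
    | true :: v => true :: dFun v
  def dFun : List Bool → List Bool
    | [] => []
    | false :: v => false :: v
    | true :: v => true :: bFun v
end

theorem aFun_invol : Function.Involutive aFun := by
  intro v; cases v <;> simp [aFun]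

theorem bcd_invol : ∀ v, bFun (bFun v) = v ∧ cFun (cFun v) = v ∧ dFun (dFun v) = v := by
  intro v
  induction v with
  | nil => simp [bFun, cFun, dFun]
  | cons x v ih =>
    cases x <;> simp [bFun, cFun, dFun, aFun_invol v, ih.1, ih.2.1, ih.2.2]

/-- The automorphism `a` of the binary tree. -/
def a : Equiv.Perm (List Bool) := Function.Involutive.toPerm aFun aFun_invol

def b : Equiv.Perm (List Bool) := Function.Involutive.toPerm bFun (fun v => (bcd_invol v).1)

def c : Equiv.Perm (List Bool) := Function.Involutive.toPerm cFun (fun v => (bcd_invol v).2.1)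

def d : Equiv.Perm (List Bool) := Function.Involutive.toPerm dFun (fun v => (bcd_invol v).2.2)

/-- The Grigorchuk group, as the subgroup generated by `a, b, c, d` inside the
permutation group of the vertex set of the binary tree. -/
def grigG : Subgroup (Equiv.Perm (List Bool)) := Subgroup.closure {a, b, c, d}

end Grig

namespace Grig

theorem bcd_mul : ∀ v, bFun (cFun v) = dFun v ∧ cFun (bFun v) = dFun v ∧
    cFun (dFun v) = bFun v ∧ dFun (cFun v) = bFun v ∧
    bFun (dFun v) = cFun v ∧ dFun (bFun v) = cFun v := by
  intro v
  induction v with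
  | nil => simp [bFun, cFun, dFun]
  | cons x v ih =>
    obtain ⟨h1, h2, h3, h4, h5, h6⟩ := ih
    cases x <;> simp [bFun, cFun, dFun, aFun_invol v, h1, h2, h3, h4, h5, h6]

/-- The Klein four-group `{1, b, c, d}`. -/
inductive K
  | e | b | c | d

def K.ev : K → Equiv.Perm (List Bool)
  | .e => 1
  | .b => Grig.b
  | .c => Grig.c
  | .d => Grig.d

def K.wt : K → ℕ
  | .e => 0
  | .b => 3
  | .c => 2
  | .d => 1

theorem aa : a * a = 1 := Equiv.ext fun v => aFun_invol v
theorem bb : b * b = 1 := Equiv.ext fun v => (bcd_invol v).1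
theorem cc : c * c = 1 := Equiv.ext fun v => (bcd_invol v).2.1
theorem dd : d * d = 1 := Equiv.ext fun v => (bcd_invol v).2.2
theorem bc : b * c = d := Equiv.ext fun v => (bcd_mul v).1
theorem cb : c * b = d := Equiv.ext fun v => (bcd_mul v).2.1
theorem cd : c * d = b := Equiv.ext fun v => (bcd_mul v).2.2.1
theorem dc : d * c = b := Equiv.ext fun v => (bcd_mul v).2.2.2.1
theorem bd : b * d = c := Equiv.ext fun v => (bcd_mul v).2.2.2.2.1
theorem db : d * b = c := Equiv.ext fun v => (bcd_mul v).2.2.2.2.2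

theorem K.sq (x : K) : x.ev * x.ev = 1 := by
  cases x <;> simp [K.ev, bb, cc, dd]

theorem K.mul (x y : K) : ∃ z : K, z.ev = x.ev * y.ev ∧ z.wt ≤ x.wt + y.wt := by
  cases x <;> cases y <;>
  first
  | (refine ⟨.e, ?_, ?_⟩; (· simp [K.ev, bb, cc, dd]); (· simp [K.wt]))
  | (refine ⟨.b, ?_, ?_⟩; (· simp [K.ev, cd, dc]); (· simp [K.wt]))
  | (refine ⟨.c, ?_, ?_⟩; (· simp [K.ev, bd, db]); (· simp [K.wt]))
  | (refine ⟨.d, ?_, ?_⟩; (· simp [K.ev, bc, cb]); (· simp [K.wt]))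

/-- `W n g`: `g` is the value of a word of weight at most `n`. -/
inductive W : ℕ → Equiv.Perm (List Bool) → Prop
  | one (n : ℕ) : W n 1
  | a {n g} : W n g → W (3 + n) (Grig.a * g)
  | k {n g} (x : K) : W n g → W (x.wt + n) (x.ev * g)

theorem W.mul {m n g h} (hg : W m g) (hh : W n h) : W (m + n) (g * h) := by
  have mono : ∀ {n g}, W n g → ∀ k, W (k + n) g := by
    intro n g hg
    induction hg with
    | one n => intro k; exact W.one _
    | a _ ih => intro k; rw [Nat.add_left_comm]; exact W.a (ih k)
    | k x _ ih => intro k; rw [Nat.add_left_comm]; exact W.k x (ih k)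
  induction hg with
  | one m => rw [one_mul]; exact mono hh m
  | a _ ih => rw [mul_assoc, add_assoc]; exact W.a ih
  | k x _ ih => rw [mul_assoc, add_assoc]; exact W.k x ih

theorem W.a1 : W 3 Grig.a := by simpa using W.a (W.one 0)
theorem W.k1 (x : K) : W x.wt x.ev := by simpa using W.k x (W.one 0)

theorem W.inv {n g} (hg : W n g) : W n g⁻¹ := by
  induction hg with
  | one m => rw [inv_one]; exact W.one m
  | a _ ih =>
    rw [mul_inv_rev, inv_eq_of_mul_eq_one_right aa, add_comm]; exact ih.mul W.a1
  | k x _ ih =>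
    rw [mul_inv_rev, inv_eq_of_mul_eq_one_right x.sq, add_comm]; exact ih.mul (W.k1 x)

def V (L : List K) : Equiv.Perm (List Bool) := (L.map fun x => a * x.ev).prod
def VW (L : List K) : ℕ := (L.map fun x => 3 + x.wt).sum

theorem W.nf {n g} (hg : W n g) : ∃ (p : K) (L : List K), g = p.ev * V L ∧ p.wt + VW L ≤ n := by
  induction hg with
  | one n => exact ⟨.e, [], by simp [K.ev, V], by simp [K.wt, VW]⟩
  | a _ ih =>
    obtain ⟨p, L, rfl, h⟩ := ih
    refine ⟨.e, p :: L, by simp [K.ev, V, mul_assoc], ?_⟩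
    simp only [K.wt, VW, List.map_cons, List.sum_cons] at h ⊢
    omega
  | k x _ ih =>
    obtain ⟨p, L, rfl, h⟩ := ih
    obtain ⟨z, hz, hw⟩ := K.mul x p
    exact ⟨z, L, by rw [hz, mul_assoc], by omega⟩

theorem a_app (v : List Bool) : a v = aFun v := rfl
theorem b_app (v : List Bool) : b v = bFun v := rfl
theorem c_app (v : List Bool) : c v = cFun v := rfl
theorem d_app (v : List Bool) : d v = dFun v := rfl

/-- Sections of an element of the Klein group, with the weight estimate. -/
theorem K_sec (x : K) : ∃ (g0 g1 : Equiv.Perm (List Bool)) (m0 m1 : ℕ), W m0 g0 ∧ W m1 g1 ∧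
    m0 + m1 < 3 + x.wt ∧ x.ev [] = [] ∧ (∀ v, x.ev (false :: v) = false :: g0 v) ∧
    (∀ v, x.ev (true :: v) = true :: g1 v) := by
  cases x
  · exact ⟨1, 1, 0, 0, W.one _, W.one _, by simp [K.wt], rfl, fun _ => rfl, fun _ => rfl⟩
  · exact ⟨a, c, 3, 2, W.a1, W.k1 .c, by simp [K.wt], by simp [K.ev, b_app, bFun],
      by simp [K.ev, b_app, bFun, a_app], by simp [K.ev, b_app, bFun, c_app]⟩
  · exact ⟨a, d, 3, 1, W.a1, W.k1 .d, by simp [K.wt], by simp [K.ev, c_app, cFun],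
      by simp [K.ev, c_app, cFun, a_app], by simp [K.ev, c_app, cFun, d_app]⟩
  · exact ⟨1, b, 0, 3, W.one _, W.k1 .b, by simp [K.wt], by simp [K.ev, d_app, dFun],
      by simp [K.ev, d_app, dFun], by simp [K.ev, d_app, dFun, b_app]⟩

theorem V_sec (L : List K) : ∃ (s : Bool) (g0 g1 : Equiv.Perm (List Bool)) (m0 m1 : ℕ),
    W m0 g0 ∧ W m1 g1 ∧ m0 + m1 + L.length ≤ VW L ∧ V L [] = [] ∧
    (∀ v, V L (false :: v) = s :: g0 v) ∧ (∀ v, V L (true :: v) = (!s) :: g1 v) := by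
  induction L with
  | nil => exact ⟨false, 1, 1, 0, 0, W.one _, W.one _, by simp [VW], rfl, fun _ => rfl, fun _ => rfl⟩
  | cons x L ih =>
    obtain ⟨s, g0, g1, m0, m1, h0, h1, hm, hn, hf, ht⟩ := ih
    obtain ⟨k0, k1, n0, n1, i0, i1, im, hin, hif, hit⟩ := K_sec x
    have hV : ∀ v, V (x :: L) v = aFun (x.ev (V L v)) := by
      intro v; simp [V, a]
    have hW : VW (x :: L) = 3 + x.wt + VW L := by simp [VW]
    have hl : (x :: L).length = L.length + 1 := rfl
    cases s
    · exact ⟨true, k0 * g0, k1 * g1, n0 + m0, n1 + m1, i0.mul h0, i1.mul h1, by omega,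
        by rw [hV, hn, hin, aFun], by intro v; rw [hV, hf, hif]; rfl,
        by intro v; rw [hV, ht]; simp [hit, aFun]⟩
    · exact ⟨false, k1 * g0, k0 * g1, n1 + m0, n0 + m1, i1.mul h0, i0.mul h1, by omega,
        by rw [hV, hn, hin, aFun], by intro v; rw [hV, hf, hit]; rfl,
        by intro v; rw [hV, ht]; simp [hif, aFun]⟩

theorem stab {g g0 g1 : Equiv.Perm (List Bool)} (hn : g [] = [])
    (hf : ∀ v, g (false :: v) = false :: g0 v) (ht : ∀ v, g (true :: v) = true :: g1 v)
    (h0 : ∃ k : ℕ, g0 ^ (2 ^ k) = 1) (h1 : ∃ k : ℕ, g1 ^ (2 ^ k) = 1) :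
    ∃ k : ℕ, g ^ (2 ^ k) = 1 := by
  obtain ⟨k0, h0⟩ := h0
  obtain ⟨k1, h1⟩ := h1
  have key : ∀ n : ℕ, (g ^ n) [] = [] ∧ (∀ v, (g ^ n) (false :: v) = false :: (g0 ^ n) v) ∧
      (∀ v, (g ^ n) (true :: v) = true :: (g1 ^ n) v) := by
    intro n
    induction n with
    | zero => simp
    | succ n ih =>
      obtain ⟨i1, i2, i3⟩ := ih
      simp [pow_succ, hn, hf, ht, i1, i2, i3]
  refine ⟨k0 + k1, Equiv.ext fun v => ?_⟩
  have e0 : g0 ^ (2 ^ (k0 + k1)) = 1 := by rw [pow_add, pow_mul, h0, one_pow]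
  have e1 : g1 ^ (2 ^ (k0 + k1)) = 1 := by rw [add_comm, pow_add, pow_mul, h1, one_pow]
  obtain ⟨i1, i2, i3⟩ := key (2 ^ (k0 + k1))
  match v with
  | [] => exact i1
  | false :: v => rw [i2, e0]; rfl
  | true :: v => rw [i3, e1]; rfl

theorem V_periodic (n : ℕ) (IH : ∀ m < n, ∀ g, W m g → ∃ k : ℕ, g ^ (2 ^ k) = 1)
    (L : List K) (hL : VW L ≤ n) (hne : L ≠ []) : ∃ k : ℕ, V L ^ (2 ^ k) = 1 := by
  obtain ⟨s, g0, g1, m0, m1, h0, h1, hm, hn, hf, ht⟩ := V_sec L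
  have hl := List.length_pos_iff.2 hne
  cases s
  · exact stab hn hf ht (IH m0 (by omega) _ h0) (IH m1 (by omega) _ h1)
  · obtain ⟨k, hk⟩ := stab (g := V L ^ 2) (g0 := g1 * g0) (g1 := g0 * g1)
      (by simp [pow_two, hn]) (by intro v; simp [pow_two, hf, ht])
      (by intro v; simp [pow_two, hf, ht])
      (IH (m1 + m0) (by omega) _ (h1.mul h0)) (IH (m0 + m1) (by omega) _ (h0.mul h1))
    exact ⟨k + 1, by rw [pow_succ', pow_mul, hk]⟩

theorem conj_periodic {p h : Equiv.Perm (List Bool)} (H : ∃ k : ℕ, (h * p) ^ (2 ^ k) = 1) :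
    ∃ k : ℕ, (p * h) ^ (2 ^ k) = 1 := by
  obtain ⟨k, hk⟩ := H
  refine ⟨k, ?_⟩
  have : p * h = p * (h * p) * p⁻¹ := by group
  rw [this, conj_pow, hk]; group

theorem W.periodic (n : ℕ) : ∀ g, W n g → ∃ k : ℕ, g ^ (2 ^ k) = 1 := by
  induction n using Nat.strong_induction_on with
  | _ n IH =>
    intro g hg
    obtain ⟨p, L, rfl, h⟩ := hg.nf
    rcases List.eq_nil_or_concat L with rfl | ⟨L', y, rfl⟩
    · exact ⟨1, by simp [V, pow_two, p.sq]⟩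
    · apply conj_periodic
      obtain ⟨z, hz, hw⟩ := K.mul y p
      have e : V (L' ++ [y]) * p.ev = V (L' ++ [z]) := by simp [V, hz, mul_assoc]
      simp only [List.concat_eq_append] at *
      rw [e]
      refine V_periodic n IH _ ?_ (by simp)
      simp [VW] at h ⊢
      omega

/-- The Grigorchuk group is a periodic 2-group: every element has order a power of 2. -/
theorem grigG_periodic : ∀ g ∈ grigG, ∃ k : ℕ, g ^ (2 ^ k) = 1 := by
  intro g hg
  have : ∃ n, W n g := by
    refine Subgroup.closure_induction (p := fun g _ => ∃ n, W n g) ?_ ⟨0, W.one 0⟩ ?_ ?_ hg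
    · rintro x (rfl | rfl | rfl | rfl)
      exacts [⟨_, W.a1⟩, ⟨_, W.k1 .b⟩, ⟨_, W.k1 .c⟩, ⟨_, W.k1 .d⟩]
    · rintro x y _ _ ⟨m, hm⟩ ⟨n, hn⟩
      exact ⟨_, hm.mul hn⟩
    · rintro x _ ⟨m, hm⟩
      exact ⟨_, hm.inv⟩
  obtain ⟨n, hn⟩ := this
  exact W.periodic n g hn

end Grig
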